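/- (Resolution of the recursion.) Let 1 ≤ m < M ≤ n, let ε, ζ ∈ {1,−1}, and let t_m ∈ {𝒯_m, τ_m}. Then the element τ_M^ε 𝒯_M^{−ε} t_m^ζ of H_{2,n}(q) lies in the ℤ[q,q⁻¹]-submodule spanned by the elements of the form s₀ s₁ s₂ G, where s₀ is a looping of index m, s₁ and s₂ are loopings whose indices m₁, m₂ satisfy m ≤ m₁ ≤ m₂ ≤ M, and G is a finite product of elements gᵢ^{±1} with i ∈ [m, M−1]. In particular, every spanning term starts with a looping of index m. (Lemma 4.) -/

import Mathlib

noncomputable section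

namespace MixedHecke

/-- The ring `ℤ[q,q⁻¹]` of Laurent polynomials over `ℤ`. -/
abbrev R : Type := LaurentPolynomial ℤ

/-- The variable `q`. -/
def q : R := LaurentPolynomial.T 1

/-- The inverse `q⁻¹` of the variable `q`. -/
def qinv : R := LaurentPolynomial.T (-1)

/-- Generators of the mixed braid group `B_{2,n}`:
`Sum.inl true` is `𝒯`, `Sum.inl false` is `τ`, and `Sum.inr ⟨i, _⟩` is `σ_i` for `1 ≤ i ≤ n-1`. -/
def Gen (n : ℕ) : Type := Bool ⊕ {i : ℕ // 1 ≤ i ∧ i < n}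

/-- The generator `𝒯` in the free group. -/
def fT (n : ℕ) : FreeGroup (Gen n) := FreeGroup.of (Sum.inl true)

/-- The generator `τ` in the free group. -/
def ftau (n : ℕ) : FreeGroup (Gen n) := FreeGroup.of (Sum.inl false)

/-- The generator `σ_i` in the free group (junk value `1` for `i` out of range). -/
def fs (n i : ℕ) : FreeGroup (Gen n) :=
  if h : 1 ≤ i ∧ i < n then FreeGroup.of (Sum.inr ⟨i, h⟩) else 1

/-- The defining relators of the mixed braid group `B_{2,n}`. -/
def rels (n : ℕ) : Set (FreeGroup (Gen n)) :=
  { x | (∃ k j, 1 ≤ j ∧ j + 1 < k ∧ k < n ∧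
          x = fs n k * fs n j * (fs n j * fs n k)⁻¹) ∨
        (∃ k, 1 ≤ k ∧ k + 1 < n ∧
          x = fs n k * fs n (k+1) * fs n k * (fs n (k+1) * fs n k * fs n (k+1))⁻¹) ∨
        (∃ k, 2 ≤ k ∧ k < n ∧ x = fT n * fs n k * (fs n k * fT n)⁻¹) ∨
        (∃ k, 2 ≤ k ∧ k < n ∧ x = ftau n * fs n k * (fs n k * ftau n)⁻¹) ∨
        (1 < n ∧ x = fT n * fs n 1 * fT n * fs n 1 * (fs n 1 * fT n * fs n 1 * fT n)⁻¹) ∨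
        (1 < n ∧ x = ftau n * fs n 1 * ftau n * fs n 1 * (fs n 1 * ftau n * fs n 1 * ftau n)⁻¹) ∨
        (1 < n ∧ x = ftau n * (fs n 1 * fT n * fs n 1) * ((fs n 1 * fT n * fs n 1) * ftau n)⁻¹) }

/-- The mixed braid group `B_{2,n}` on two fixed strands. -/
abbrev B (n : ℕ) : Type := PresentedGroup (rels n)

/-- The group algebra `ℤ[q,q⁻¹] B_{2,n}`. -/
abbrev GA (n : ℕ) : Type := MonoidAlgebra R (B n)

/-- The image of `σ_i` in the group algebra. -/
def gA (n i : ℕ) : GA n := MonoidAlgebra.of R (B n) (PresentedGroup.mk (rels n) (fs n i))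

/-- The quadratic relations `σ_i² = (q-1)σ_i + q·1`, `i = 1, …, n-1`. -/
inductive quadRel (n : ℕ) : GA n → GA n → Prop
  | intro (i : ℕ) (h1 : 1 ≤ i) (h2 : i < n) :
      quadRel n (gA n i * gA n i) ((q - 1) • gA n i + q • (1 : GA n))

/-- The mixed Hecke algebra `H_{2,n}(q)`: the quotient of the group algebra `ℤ[q,q⁻¹] B_{2,n}`
by the two-sided ideal generated by the quadratic relations. -/
abbrev H (n : ℕ) : Type := RingQuot (quadRel n)

/-- The canonical monoid homomorphism `B_{2,n} →* H_{2,n}(q)`. -/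
def π (n : ℕ) : B n →* H n :=
  (RingQuot.mkAlgHom R (quadRel n)).toMonoidHom.comp (MonoidAlgebra.of R (B n))

/-- The canonical map from the free group on the generators to the units of `H_{2,n}(q)`
(images of group elements are units). -/
def U (n : ℕ) : FreeGroup (Gen n) →* (H n)ˣ :=
  ((π n).comp (PresentedGroup.mk (rels n))).toHomUnits

/-- The braiding generator `g_i` as a unit of `H_{2,n}(q)`. -/
def g (n i : ℕ) : (H n)ˣ := U n (fs n i)

/-- The word for the looping element `𝒯_i` : `𝒯_1 = 𝒯` and `𝒯_{i+1} = σ_i 𝒯_i σ_i`,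
i.e. `𝒯_i = σ_{i-1} ⋯ σ_1 𝒯 σ_1 ⋯ σ_{i-1}`. -/
def wT (n : ℕ) : ℕ → FreeGroup (Gen n)
  | 0 => 1
  | 1 => fT n
  | (i+2) => fs n (i+1) * wT n (i+1) * fs n (i+1)

/-- The word for the looping element `τ_i` : `τ_1 = τ` and `τ_{i+1} = σ_i τ_i σ_i`,
i.e. `τ_i = σ_{i-1} ⋯ σ_1 τ σ_1 ⋯ σ_{i-1}`. -/
def wtau (n : ℕ) : ℕ → FreeGroup (Gen n)
  | 0 => 1
  | 1 => ftau n
  | (i+2) => fs n (i+1) * wtau n (i+1) * fs n (i+1)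

/-- The looping element `𝒯_i` as a unit of `H_{2,n}(q)`. -/
def T (n i : ℕ) : (H n)ˣ := U n (wT n i)

/-- The looping element `τ_i` as a unit of `H_{2,n}(q)`. -/
def tau (n i : ℕ) : (H n)ˣ := U n (wtau n i)

/-- The loopings of index `i` : `𝒯_i, τ_i, 𝒯_i⁻¹, τ_i⁻¹`, as units of `H_{2,n}(q)`. -/
def LoopU (n i : ℕ) : Set (H n)ˣ := {T n i, tau n i, (T n i)⁻¹, (tau n i)⁻¹}

/-- The braiding generators `g_i`, `1 ≤ i ≤ n-1`, as elements of `H_{2,n}(q)`. -/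
def BraidGens (n : ℕ) : Set (H n) := {x | ∃ i, 1 ≤ i ∧ i < n ∧ x = (g n i : H n)}

/-- The elements `g_i^{±1}` with `lo ≤ i ≤ hi - 1`, as elements of `H_{2,n}(q)`. -/
def BraidPM (n lo hi : ℕ) : Set (H n) :=
  {x | ∃ i, lo ≤ i ∧ i < hi ∧ (x = (g n i : H n) ∨ x = ((g n i)⁻¹ : (H n)ˣ))}

section CommutingLoopings

variable {G : Type*} [Group G]

theorem commute_mul_mul_self {a b c : G} (hb : Commute a b) (hc : Commute a c) :
    Commute a (b * c * b) :=
  (hb.mul_right hc).mul_right hb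

/-- If `a` and `b` satisfy the braid relation and `b` commutes with `x`, then `a` commutes
with `b a x a b`. -/
theorem commute_braid_conj {a b x : G} (hab : a * b * a = b * a * b) (hx : Commute b x) :
    Commute a (b * (a * x * a) * b) := by
  have e : a * x * a * b * a = a * x * (a * b * a) := by group
  calc a * (b * (a * x * a) * b) = (a * b * a) * x * a * b := by group
    _ = b * a * (b * x) * a * b := by rw [hab]; group
    _ = b * a * x * (b * a * b) := by rw [hx.eq]; group
    _ = b * (a * x * a) * b * a := by rw [← hab]; group

variable {n : ℕ} {g X Y : ℕ → G}

/-- The looping `Xⱼ` commutes with the braidings `gᵢ` for `j < i`. -/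
theorem commute_braiding_looping_of_lt
    (far : ∀ k j, 1 ≤ j → j + 1 < k → k < n → Commute (g k) (g j))
    (hX : ∀ i, 1 ≤ i → X (i + 1) = g i * X i * g i)
    (X_one : ∀ k, 2 ≤ k → k < n → Commute (g k) (X 1))
    {j i : ℕ} (hj : 1 ≤ j) (hji : j < i) (hi : i < n) : Commute (g i) (X j) := by
  induction j, hj using Nat.le_induction with
  | base => exact X_one i hji hi
  | succ j hj ih =>
    rw [hX j hj]
    exact commute_mul_mul_self (far i j hj hji hi) (ih (by omega))

/-- The looping `Xⱼ` commutes with the braidings `gᵢ` for `i + 1 < j`. -/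
theorem commute_braiding_looping_of_gt
    (far : ∀ k j, 1 ≤ j → j + 1 < k → k < n → Commute (g k) (g j))
    (braid : ∀ k, 1 ≤ k → k + 1 < n → g k * g (k + 1) * g k = g (k + 1) * g k * g (k + 1))
    (hX : ∀ i, 1 ≤ i → X (i + 1) = g i * X i * g i)
    (X_one : ∀ k, 2 ≤ k → k < n → Commute (g k) (X 1))
    {i j : ℕ} (hi : 1 ≤ i) (hij : i + 2 ≤ j) (hj : j ≤ n) : Commute (g i) (X j) := by
  induction j, hij using Nat.le_induction with
  | base =>
    rw [hX (i + 1) (by omega), hX i hi]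
    exact commute_braid_conj (braid i hi (by omega))
      (commute_braiding_looping_of_lt far hX X_one hi (by omega) (by omega))
  | succ j hij ih =>
    rw [hX j (by omega)]
    exact commute_mul_mul_self (far j i hi (by omega) (by omega)).symm (ih (by omega))

/-- Loopings `Xᵢ` and `Yⱼ` with `i < j` commute as soon as `X₁` and `Y₂` do. -/
theorem commute_looping_looping
    (far : ∀ k j, 1 ≤ j → j + 1 < k → k < n → Commute (g k) (g j))
    (braid : ∀ k, 1 ≤ k → k + 1 < n → g k * g (k + 1) * g k = g (k + 1) * g k * g (k + 1))
    (hX : ∀ i, 1 ≤ i → X (i + 1) = g i * X i * g i)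
    (hY : ∀ i, 1 ≤ i → Y (i + 1) = g i * Y i * g i)
    (X_one : ∀ k, 2 ≤ k → k < n → Commute (g k) (X 1))
    (Y_one : ∀ k, 2 ≤ k → k < n → Commute (g k) (Y 1))
    (one_two : 1 < n → Commute (X 1) (g 1 * Y 1 * g 1))
    {i j : ℕ} (hi : 1 ≤ i) (hij : i < j) (hj : j ≤ n) : Commute (X i) (Y j) := by
  induction i, hi using Nat.le_induction with
  | base =>
    induction j, hij using Nat.le_induction with
    | base => rw [hY 1 le_rfl]; exact one_two (by omega)
    | succ j hij ih =>
      rw [hY j (by omega)]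
      exact commute_mul_mul_self (X_one j hij (by omega)).symm (ih (by omega))
  | succ i hi ih =>
    rw [hX i hi]
    exact (commute_mul_mul_self
      (commute_braiding_looping_of_gt far braid hY Y_one hi (by omega) hj).symm
      (ih (by omega)).symm).symm

end CommutingLoopings

section LoopingSystem

variable {S A : Type*} [CommSemiring S] [Semiring A] [Algebra S A]

/-- Braidings `gᵢ` and two families of loopings `Xᵢ`, `Yᵢ` of an algebra, with the relations of
the mixed Hecke algebra that are stable under inverting all generators. -/
structure LoopingSystem (S : Type*) {A : Type*} [CommSemiring S] [Semiring A] [Algebra S A]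
    (n : ℕ) (g X Y : ℕ → Aˣ) : Prop where
  X_succ : ∀ i, 1 ≤ i → X (i + 1) = g i * X i * g i
  Y_succ : ∀ i, 1 ≤ i → Y (i + 1) = g i * Y i * g i
  braid_X : ∀ i j, 1 ≤ j → j < i → i < n → Commute (g i) (X j)
  braid_Y : ∀ i j, 1 ≤ j → j < i → i < n → Commute (g i) (Y j)
  X_Y : ∀ i, 1 ≤ i → i < n → Commute (X i) (Y (i + 1))
  Y_Y : ∀ i, 1 ≤ i → i < n → Commute (Y i) (Y (i + 1))
  quad : ∀ i, 1 ≤ i → i < n → ∃ a b : S, (g i : A) = a • ((g i)⁻¹ : Aˣ) + b • (1 : A)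
  quad_inv : ∀ i, 1 ≤ i → i < n → ∃ a b : S, (((g i)⁻¹ : Aˣ) : A) = a • (g i : A) + b • (1 : A)

/-- The loopings of index `i` for two families of loopings. -/
def loopings (X Y : ℕ → Aˣ) (i : ℕ) : Set Aˣ := {Y i, X i, (Y i)⁻¹, (X i)⁻¹}

/-- The products `s₀ s₁ s₂ G` with `s₀` of index `m`, `s₁`, `s₂` of indices
`m ≤ m₁ ≤ m₂ ≤ M`, and `G` a product of braidings, in which two loopings of index `M` occur only
as `X_M Y_M⁻¹`. -/
def sortedWords (g X Y : ℕ → Aˣ) (m M : ℕ) : Set A :=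
  {x | ∃ (m1 m2 : ℕ) (s0 s1 s2 G : Aˣ), m ≤ m1 ∧ m1 ≤ m2 ∧ m2 ≤ M ∧
    s0 ∈ loopings X Y m ∧ s1 ∈ loopings X Y m1 ∧ s2 ∈ loopings X Y m2 ∧
    G ∈ Subgroup.closure (g '' Set.Ico m M) ∧
    (m1 < M ∨ m1 = M ∧ s1 = X M ∧ s2 = (Y M)⁻¹) ∧ x = ((s0 * s1 * s2 * G : Aˣ) : A)}

namespace LoopingSystem

variable {n : ℕ} {g X Y : ℕ → Aˣ}

theorem inv (h : LoopingSystem S n g X Y) :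
    LoopingSystem S n (fun i => (g i)⁻¹) (fun i => (X i)⁻¹) (fun i => (Y i)⁻¹) where
  X_succ i hi := by simp only [h.X_succ i hi]; group
  Y_succ i hi := by simp only [h.Y_succ i hi]; group
  braid_X i j hj hji hi := (h.braid_X i j hj hji hi).inv_inv
  braid_Y i j hj hji hi := (h.braid_Y i j hj hji hi).inv_inv
  X_Y i hi hin := (h.X_Y i hi hin).inv_inv
  Y_Y i hi hin := (h.Y_Y i hi hin).inv_inv
  quad i hi hin := by simpa only [inv_inv] using h.quad_inv i hi hin
  quad_inv i hi hin := by simpa only [inv_inv] using h.quad i hi hin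

theorem commute_braiding_of_mem_loopings (h : LoopingSystem S n g X Y) {i j : ℕ} (hj : 1 ≤ j)
    (hji : j < i) (hi : i < n) {s : Aˣ} (hs : s ∈ loopings X Y j) : Commute (g i) s := by
  have hX := h.braid_X i j hj hji hi
  have hY := h.braid_Y i j hj hji hi
  rcases hs with rfl | rfl | rfl | rfl
  exacts [hY, hX, hY.inv_right, hX.inv_right]

/-- A braiding `gᵢ` moves to the right past a looping of index `i`. -/
theorem braiding_mul_looping (h : LoopingSystem S n g X Y) {i : ℕ} (hi : 1 ≤ i)
    {s : Aˣ} (hs : s ∈ loopings X Y i) :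
    (∃ s' ∈ loopings X Y (i + 1), g i * s = s' * (g i)⁻¹) ∨
      ∃ s' ∈ loopings X Y (i + 1), (g i)⁻¹ * s = s' * g i := by
  rcases hs with rfl | rfl | rfl | rfl
  · exact .inl ⟨Y (i + 1), by simp [loopings], by rw [h.Y_succ i hi]; group⟩
  · exact .inl ⟨X (i + 1), by simp [loopings], by rw [h.X_succ i hi]; group⟩
  · exact .inr ⟨(Y (i + 1))⁻¹, by simp [loopings], by rw [h.Y_succ i hi]; group⟩
  · exact .inr ⟨(X (i + 1))⁻¹, by simp [loopings], by rw [h.X_succ i hi]; group⟩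

/-- Conjugation by `g_M` carries sorted words with indices in `[m, M]` to combinations of sorted
words with indices in `[m, M + 1]`. -/
theorem conj_mem_span_sortedWords (h : LoopingSystem S n g X Y) {m M : ℕ} (hm : 1 ≤ m)
    (hmM : m < M) (hMn : M < n) {x : A} (hx : x ∈ Submodule.span S (sortedWords g X Y m M)) :
    (g M : A) * x * ((g M)⁻¹ : Aˣ) ∈ Submodule.span S (sortedWords g X Y m (M + 1)) := by
  have hgM : g M ∈ Subgroup.closure (g '' Set.Ico m (M + 1)) :=
    Subgroup.subset_closure ⟨M, ⟨hmM.le, by omega⟩, rfl⟩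
  induction hx using Submodule.span_induction with
  | zero => simp
  | add x y _ _ hx hy => rw [mul_add, add_mul]; exact add_mem hx hy
  | smul a x _ hx =>
    rw [mul_smul_comm, smul_mul_assoc]; exact Submodule.smul_mem _ _ hx
  | mem x hx =>
    obtain ⟨m1, m2, s0, s1, s2, G, h1, h12, h2, hs0, hs1, hs2, hG, hlast, rfl⟩ := hx
    replace hG : G ∈ Subgroup.closure (g '' Set.Ico m (M + 1)) :=
      Subgroup.closure_mono (Set.image_mono (Set.Ico_subset_Ico_right (by omega))) hG
    have c0 := (h.commute_braiding_of_mem_loopings hm hmM hMn hs0).eq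
    rcases hlast with hlt | ⟨rfl, rfl, rfl⟩
    · have c1 := (h.commute_braiding_of_mem_loopings (hm.trans h1) hlt hMn hs1).eq
      have c01 : g M * (s0 * s1) = s0 * s1 * g M := by
        rw [← mul_assoc, c0, mul_assoc, c1, mul_assoc]
      rcases h2.lt_or_eq with h2 | rfl
      · have c2 := (h.commute_braiding_of_mem_loopings (by omega) h2 hMn hs2).eq
        refine Submodule.subset_span ⟨m1, m2, s0, s1, s2, g M * G * (g M)⁻¹, h1, h12, by omega,
          hs0, hs1, hs2, mul_mem (mul_mem hgM hG) (inv_mem hgM), .inl (by omega), ?_⟩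
        norm_cast
        calc g M * (s0 * s1 * s2 * G) * (g M)⁻¹
            = g M * (s0 * s1) * s2 * G * (g M)⁻¹ := by group
          _ = s0 * s1 * (g M * s2) * G * (g M)⁻¹ := by rw [c01]; group
          _ = s0 * s1 * s2 * (g M * G * (g M)⁻¹) := by rw [c2]; group
      · have e : (g m2 : A) * ((s0 * s1 * s2 * G : Aˣ) : A) * ((g m2)⁻¹ : Aˣ)
            = ((s0 * s1 : Aˣ) : A) * (g m2 : A) * ((s2 * G * (g m2)⁻¹ : Aˣ) : A) := by
          norm_cast
          rw [← c01]; group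
        rcases h.braiding_mul_looping (hm.trans hmM.le) hs2 with
          ⟨s', hs', hg⟩ | ⟨s', hs', hg⟩
        · refine Submodule.subset_span ⟨m1, m2 + 1, s0, s1, s', (g m2)⁻¹ * G * (g m2)⁻¹, h1,
            by omega, le_rfl, hs0, hs1, hs', mul_mem (mul_mem (inv_mem hgM) hG) (inv_mem hgM),
            .inl (by omega), ?_⟩
          rw [e]
          norm_cast
          calc s0 * s1 * g m2 * (s2 * G * (g m2)⁻¹)
              = s0 * s1 * (g m2 * s2) * G * (g m2)⁻¹ := by group
            _ = s0 * s1 * s' * ((g m2)⁻¹ * G * (g m2)⁻¹) := by rw [hg]; group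
        · obtain ⟨a, b, hab⟩ := h.quad m2 (hm.trans hmM.le) hMn
          rw [e, hab, mul_add, add_mul, mul_smul_comm, smul_mul_assoc, mul_smul_comm,
            smul_mul_assoc, mul_one]
          refine add_mem (Submodule.smul_mem _ _ (Submodule.subset_span ?_))
            (Submodule.smul_mem _ _ (Submodule.subset_span ?_))
          · refine ⟨m1, m2 + 1, s0, s1, s', g m2 * G * (g m2)⁻¹, h1,
              by omega, le_rfl, hs0, hs1, hs', mul_mem (mul_mem hgM hG) (inv_mem hgM),
              .inl (by omega), ?_⟩
            norm_cast
            calc s0 * s1 * (g m2)⁻¹ * (s2 * G * (g m2)⁻¹)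
                = s0 * s1 * ((g m2)⁻¹ * s2) * G * (g m2)⁻¹ := by group
              _ = s0 * s1 * s' * (g m2 * G * (g m2)⁻¹) := by rw [hg]; group
          · refine ⟨m1, m2, s0, s1, s2, G * (g m2)⁻¹, h1, h12, by omega, hs0, hs1, hs2,
              mul_mem hG (inv_mem hgM), .inl (by omega), ?_⟩
            norm_cast
            group
    · refine Submodule.subset_span ⟨m1 + 1, m1 + 1, s0, X (m1 + 1), (Y (m1 + 1))⁻¹,
        g m1 * G * (g m1)⁻¹, by omega, le_rfl, le_rfl, hs0, by simp [loopings],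
        by simp [loopings], mul_mem (mul_mem hgM hG) (inv_mem hgM), .inr ⟨rfl, rfl, rfl⟩, ?_⟩
      norm_cast
      rw [h.X_succ m1 (by omega), h.Y_succ m1 (by omega)]
      calc g m1 * (s0 * X m1 * (Y m1)⁻¹ * G) * (g m1)⁻¹
          = g m1 * s0 * X m1 * (Y m1)⁻¹ * G * (g m1)⁻¹ := by group
        _ = _ := by rw [c0]; group

/-- Sorting `X_{m+1} Y_{m+1}⁻¹ Y_m`. -/
theorem mul_inv_mul_mem_span_succ (h : LoopingSystem S n g X Y) {m : ℕ} (hm : 1 ≤ m)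
    (hmn : m < n) :
    ((X (m + 1) * (Y (m + 1))⁻¹ * Y m : Aˣ) : A) ∈
      Submodule.span S (sortedWords g X Y m (m + 1)) := by
  have hg : g m ∈ Subgroup.closure (g '' Set.Ico m (m + 1)) :=
    Subgroup.subset_closure ⟨m, ⟨le_rfl, by omega⟩, rfl⟩
  have hX := h.X_succ m hm
  have hY := h.Y_succ m hm
  have hXY := (h.X_Y m hm hmn).eq
  have hYY := (h.Y_Y m hm hmn).inv_left.eq
  obtain ⟨a, b, hab⟩ := h.quad m hm hmn
  obtain ⟨c, d, hcd⟩ := h.quad_inv m hm hmn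
  have e₁ : ((X (m + 1) * (Y (m + 1))⁻¹ * Y m : Aˣ) : A)
      = ((g m * X m * (Y m)⁻¹ : Aˣ) : A) * ((g m)⁻¹ : Aˣ) * (Y m : A) := by
    norm_cast
    rw [hX, hY]; group
  have e₂ : ((g m * X m * (Y m)⁻¹ : Aˣ) : A) * (g m : A) * (Y m : A)
      = (g m : A) * ((Y (m + 1) * X m * (Y m)⁻¹ * (g m)⁻¹ : Aˣ) : A) := by
    norm_cast
    calc g m * X m * (Y m)⁻¹ * g m * Y m
        = g m * X m * ((Y m)⁻¹ * (g m * Y m * g m)) * (g m)⁻¹ := by group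
      _ = g m * (X m * Y (m + 1)) * (Y m)⁻¹ * (g m)⁻¹ := by rw [← hY, hYY]; group
      _ = g m * (Y (m + 1) * X m * (Y m)⁻¹ * (g m)⁻¹) := by rw [hXY]; group
  rw [e₁, hcd, mul_add, add_mul, mul_smul_comm, smul_mul_assoc, mul_smul_comm, smul_mul_assoc,
    e₂, hab, add_mul, smul_mul_assoc, smul_mul_assoc, one_mul, mul_one]
  refine add_mem (Submodule.smul_mem _ _ (add_mem ?_ ?_)) ?_ <;>
    refine Submodule.smul_mem _ _ (Submodule.subset_span ?_)
  · refine ⟨m + 1, m + 1, Y m, X (m + 1), (Y (m + 1))⁻¹, 1, by omega, le_rfl, le_rfl,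
      by simp [loopings], by simp [loopings], by simp [loopings], one_mem _,
      .inr ⟨rfl, rfl, rfl⟩, ?_⟩
    norm_cast
    rw [hX, hY]; group
  · refine ⟨m, m + 1, X m, (Y m)⁻¹, Y (m + 1), (g m)⁻¹, by omega, by omega, le_rfl,
      by simp [loopings], by simp [loopings], by simp [loopings], inv_mem hg,
      .inl (by omega), ?_⟩
    norm_cast
    rw [← hXY, mul_assoc (X m), ← hYY]; group
  · refine ⟨m, m + 1, (Y m)⁻¹, Y m, X (m + 1), (g m)⁻¹, by omega, by omega, le_rfl,
      by simp [loopings], by simp [loopings], by simp [loopings], inv_mem hg,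
      .inl (by omega), ?_⟩
    norm_cast
    rw [hX]; group

/-- Sorting `X_{m+1} Y_{m+1}⁻¹ Y_m⁻¹`. -/
theorem mul_inv_mul_inv_mem_span_succ (h : LoopingSystem S n g X Y) {m : ℕ} (hm : 1 ≤ m)
    (hmn : m < n) :
    ((X (m + 1) * (Y (m + 1))⁻¹ * (Y m)⁻¹ : Aˣ) : A) ∈
      Submodule.span S (sortedWords g X Y m (m + 1)) := by
  have hg : g m ∈ Subgroup.closure (g '' Set.Ico m (m + 1)) :=
    Subgroup.subset_closure ⟨m, ⟨le_rfl, by omega⟩, rfl⟩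
  have hX := h.X_succ m hm
  have hY := h.Y_succ m hm
  have hXY := (h.X_Y m hm hmn).eq
  have hYY := (h.Y_Y m hm hmn).inv_left.eq
  obtain ⟨c, d, hcd⟩ := h.quad_inv m hm hmn
  have e : ((X (m + 1) * (Y (m + 1))⁻¹ * (Y m)⁻¹ : Aˣ) : A)
      = ((Y m)⁻¹ : Aˣ) * ((g m)⁻¹ : Aˣ) * ((X m * (Y m)⁻¹ * g m : Aˣ) : A) := by
    norm_cast
    calc X (m + 1) * (Y (m + 1))⁻¹ * (Y m)⁻¹
        = (Y m)⁻¹ * (g m)⁻¹ * (Y (m + 1) * X m) * (Y m)⁻¹ * (g m)⁻¹ * (Y m)⁻¹ := by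
          rw [hX, hY]; group
      _ = (Y m)⁻¹ * (g m)⁻¹ * X m * (Y (m + 1) * (Y m)⁻¹) * (g m)⁻¹ * (Y m)⁻¹ := by
          rw [← hXY]; group
      _ = (Y m)⁻¹ * (g m)⁻¹ * (X m * (Y m)⁻¹ * g m) := by
          rw [← hYY, hY]; group
  rw [e, hcd, mul_add, add_mul, mul_smul_comm, smul_mul_assoc, mul_smul_comm, smul_mul_assoc,
    mul_one]
  refine add_mem ?_ ?_ <;> refine Submodule.smul_mem _ _ (Submodule.subset_span ?_)
  · refine ⟨m + 1, m + 1, (Y m)⁻¹, X (m + 1), (Y (m + 1))⁻¹, g m * g m, by omega, le_rfl, le_rfl,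
      by simp [loopings], by simp [loopings], by simp [loopings], mul_mem hg hg,
      .inr ⟨rfl, rfl, rfl⟩, ?_⟩
    norm_cast
    rw [hX, hY]; group
  · refine ⟨m, m, (Y m)⁻¹, X m, (Y m)⁻¹, g m, le_rfl, le_rfl, by omega,
      by simp [loopings], by simp [loopings], by simp [loopings], hg, .inl (by omega), ?_⟩
    norm_cast
    group

/-- Resolution of the recursion for the loopings `Y_m^{±1}`. -/
theorem mul_inv_mul_zpow_mem_span (h : LoopingSystem S n g X Y) {m M : ℕ} (hm : 1 ≤ m)
    (hmM : m < M) (hMn : M ≤ n) {ζ : ℤ} (hζ : ζ = 1 ∨ ζ = -1) :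
    ((X M * (Y M)⁻¹ * Y m ^ ζ : Aˣ) : A) ∈ Submodule.span S (sortedWords g X Y m M) := by
  induction M, hmM using Nat.le_induction with
  | base =>
    rcases hζ with rfl | rfl
    · simpa only [zpow_one] using h.mul_inv_mul_mem_span_succ hm hMn
    · simpa only [zpow_neg, zpow_one] using h.mul_inv_mul_inv_mem_span_succ hm hMn
  | succ M hmM ih =>
    have c := ((h.braid_Y M m hm hmM (by omega)).zpow_right ζ).inv_left.eq
    convert h.conj_mem_span_sortedWords hm hmM (by omega) (ih (by omega)) using 1
    norm_cast
    rw [h.X_succ M (by omega), h.Y_succ M (by omega)]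
    calc g M * X M * g M * (g M * Y M * g M)⁻¹ * Y m ^ ζ
        = g M * X M * (Y M)⁻¹ * ((g M)⁻¹ * Y m ^ ζ) := by group
      _ = g M * (X M * (Y M)⁻¹ * Y m ^ ζ) * (g M)⁻¹ := by rw [c]; group

end LoopingSystem

end LoopingSystem

theorem U_rel_eq {n : ℕ} {x y : FreeGroup (Gen n)} (h : x * y⁻¹ ∈ rels n) : U n x = U n y := by
  have : PresentedGroup.mk (rels n) x = PresentedGroup.mk (rels n) y := by
    rw [← mul_inv_eq_one, ← map_inv, ← map_mul]
    exact PresentedGroup.one_of_mem h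
  apply Units.ext
  simp [U, this]

theorem commute_g_g_of_lt (n k j : ℕ) (hj : 1 ≤ j) (hjk : j + 1 < k) (hk : k < n) :
    Commute (g n k) (g n j) := by
  have := U_rel_eq (n := n) (.inl ⟨k, j, hj, hjk, hk, rfl⟩)
  simp only [map_mul] at this
  exact this

theorem g_braid (n k : ℕ) (hk : 1 ≤ k) (hkn : k + 1 < n) :
    g n k * g n (k + 1) * g n k = g n (k + 1) * g n k * g n (k + 1) := by
  have := U_rel_eq (n := n) (.inr (.inl ⟨k, hk, hkn, rfl⟩))
  simp only [map_mul] at this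
  exact this

theorem commute_g_T_one (n k : ℕ) (hk : 2 ≤ k) (hkn : k < n) : Commute (g n k) (T n 1) := by
  apply Commute.symm
  have := U_rel_eq (n := n) (.inr (.inr (.inl ⟨k, hk, hkn, rfl⟩)))
  simp only [map_mul] at this
  exact this

theorem commute_g_tau_one (n k : ℕ) (hk : 2 ≤ k) (hkn : k < n) :
    Commute (g n k) (tau n 1) := by
  apply Commute.symm
  have := U_rel_eq (n := n) (.inr (.inr (.inr (.inl ⟨k, hk, hkn, rfl⟩))))
  simp only [map_mul] at this
  exact this

theorem commute_T_one_T_two (n : ℕ) (hn : 1 < n) :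
    Commute (T n 1) (g n 1 * T n 1 * g n 1) := by
  have := U_rel_eq (n := n) (.inr (.inr (.inr (.inr (.inl ⟨hn, rfl⟩)))))
  simp only [map_mul, mul_assoc] at this
  rw [commute_iff_eq]
  simp only [mul_assoc]
  exact this

theorem commute_tau_one_tau_two (n : ℕ) (hn : 1 < n) :
    Commute (tau n 1) (g n 1 * tau n 1 * g n 1) := by
  have := U_rel_eq (n := n) (.inr (.inr (.inr (.inr (.inr (.inl ⟨hn, rfl⟩))))))
  simp only [map_mul, mul_assoc] at this
  rw [commute_iff_eq]
  simp only [mul_assoc]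
  exact this

theorem commute_tau_one_T_two (n : ℕ) (hn : 1 < n) :
    Commute (tau n 1) (g n 1 * T n 1 * g n 1) := by
  have := U_rel_eq (n := n) (.inr (.inr (.inr (.inr (.inr (.inr ⟨hn, rfl⟩))))))
  simp only [map_mul, mul_assoc] at this
  rw [commute_iff_eq]
  simp only [mul_assoc]
  exact this

theorem T_succ (n i : ℕ) (hi : 1 ≤ i) : T n (i + 1) = g n i * T n i * g n i := by
  obtain ⟨i, rfl⟩ := Nat.exists_eq_add_of_le' hi
  simp only [T, g, wT, map_mul]

theorem tau_succ (n i : ℕ) (hi : 1 ≤ i) : tau n (i + 1) = g n i * tau n i * g n i := by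
  obtain ⟨i, rfl⟩ := Nat.exists_eq_add_of_le' hi
  simp only [tau, g, wtau, map_mul]

theorem g_mul_self (n i : ℕ) (hi : 1 ≤ i) (hin : i < n) :
    (g n i : H n) * g n i = (q - 1) • (g n i : H n) + q • (1 : H n) := by
  have := RingQuot.mkAlgHom_rel R (quadRel.intro i hi hin)
  simp only [map_mul, map_add, map_smul, map_one] at this
  exact this

theorem g_eq (n i : ℕ) (hi : 1 ≤ i) (hin : i < n) :
    (g n i : H n) = q • (((g n i)⁻¹ : (H n)ˣ) : H n) + (q - 1) • (1 : H n) := by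
  have := congrArg (· * (((g n i)⁻¹ : (H n)ˣ) : H n)) (g_mul_self n i hi hin)
  simpa [add_mul, mul_assoc, add_comm] using this

theorem g_inv_eq (n i : ℕ) (hi : 1 ≤ i) (hin : i < n) :
    (((g n i)⁻¹ : (H n)ˣ) : H n) = qinv • (g n i : H n) + (-(qinv * (q - 1))) • (1 : H n) := by
  have hq : qinv * q = 1 := by
    rw [qinv, q, ← LaurentPolynomial.T_add]; simp
  rw [g_eq n i hi hin, smul_add, smul_smul, smul_smul, hq, one_smul, add_assoc, ← add_smul,
    add_neg_cancel, zero_smul, add_zero]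

theorem loopingSystem (n : ℕ) : LoopingSystem R n (g n) (tau n) (T n) where
  X_succ := tau_succ n
  Y_succ := T_succ n
  braid_X _ _ := commute_braiding_looping_of_lt (commute_g_g_of_lt n) (tau_succ n)
    (commute_g_tau_one n)
  braid_Y _ _ := commute_braiding_looping_of_lt (commute_g_g_of_lt n) (T_succ n)
    (commute_g_T_one n)
  X_Y i hi hin := commute_looping_looping (commute_g_g_of_lt n) (g_braid n) (tau_succ n)
    (T_succ n) (commute_g_tau_one n) (commute_g_T_one n) (commute_tau_one_T_two n) hi
    i.lt_succ_self hin
  Y_Y i hi hin := commute_looping_looping (commute_g_g_of_lt n) (g_braid n) (T_succ n)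
    (T_succ n) (commute_g_T_one n) (commute_g_T_one n) (commute_T_one_T_two n) hi
    i.lt_succ_self hin
  quad i hi hin := ⟨_, _, g_eq n i hi hin⟩
  quad_inv i hi hin := ⟨_, _, g_inv_eq n i hi hin⟩

theorem coe_mem_closure_braidPM {n m M : ℕ} {s : Set (H n)ˣ}
    (hs : ∀ x ∈ s, ∃ i, m ≤ i ∧ i < M ∧ (x = g n i ∨ x = (g n i)⁻¹)) {G : (H n)ˣ}
    (hG : G ∈ Subgroup.closure s) : (G : H n) ∈ Submonoid.closure (BraidPM n m M) := by
  induction hG using Subgroup.closure_induction'' with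
  | mem x hx =>
    obtain ⟨i, h1, h2, rfl | rfl⟩ := hs x hx
    · exact Submonoid.subset_closure ⟨i, h1, h2, .inl rfl⟩
    · exact Submonoid.subset_closure ⟨i, h1, h2, .inr rfl⟩
  | inv_mem x hx =>
    obtain ⟨i, h1, h2, rfl | rfl⟩ := hs x hx
    · exact Submonoid.subset_closure ⟨i, h1, h2, .inr rfl⟩
    · exact Submonoid.subset_closure ⟨i, h1, h2, .inl (by rw [inv_inv])⟩
  | one => exact one_mem _
  | mul x y _ _ hx hy => rw [Units.val_mul]; exact mul_mem hx hy

theorem loopings_inv_eq_LoopU (n i : ℕ) :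
    loopings (fun i => (tau n i)⁻¹) (fun i => (T n i)⁻¹) i = LoopU n i := by
  ext x
  simp only [loopings, LoopU, inv_inv, Set.mem_insert_iff, Set.mem_singleton_iff]
  tauto

/-- **Lemma 4: resolution of the recursion.** For `m < M`, `t_m ∈ {𝒯_m, τ_m}` and
`ε, ζ ∈ {1,-1}`, the element `τ_M^ε 𝒯_M^{-ε} t_m^ζ` lies in the `ℤ[q,q⁻¹]`-submodule spanned
by the elements `s₀ s₁ s₂ G`, where `s₀` is a looping of index `m`, `s₁, s₂` are loopings of
indices `m₁, m₂` with `m ≤ m₁ ≤ m₂ ≤ M`, and `G` is a finite product of elements `g_i^{±1}`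
with `i ∈ [m, M-1]`. In particular every spanning term starts with an `m`-looping. -/
theorem lemma4 (n : ℕ) (hn : 1 ≤ n) (m M : ℕ) (hm : 1 ≤ m) (hmM : m < M) (hMn : M ≤ n)
    (ε ζ : ℤ) (hε : ε = 1 ∨ ε = -1) (hζ : ζ = 1 ∨ ζ = -1)
    (tm : (H n)ˣ) (htm : tm = T n m ∨ tm = tau n m) :
    ((tau n M ^ ε : (H n)ˣ) : H n) * ((T n M ^ (-ε) : (H n)ˣ) : H n) * ((tm ^ ζ : (H n)ˣ) : H n) ∈
      Submodule.span R
        {x : H n | ∃ (m1 m2 : ℕ) (s0 s1 s2 : (H n)ˣ) (G : H n),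
          m ≤ m1 ∧ m1 ≤ m2 ∧ m2 ≤ M ∧
          s0 ∈ LoopU n m ∧ s1 ∈ LoopU n m1 ∧ s2 ∈ LoopU n m2 ∧
          G ∈ Submonoid.closure (BraidPM n m M) ∧
          x = (s0 : H n) * (s1 : H n) * (s2 : H n) * G} := by
  rcases htm with rfl | rfl
  · rcases hε with rfl | rfl
    · have key := (loopingSystem n).mul_inv_mul_zpow_mem_span hm hmM hMn hζ
      simp only [zpow_neg, zpow_one, ← Units.val_mul]
      refine Submodule.span_mono ?_ key
      rintro x ⟨m1, m2, s0, s1, s2, G, h1, h12, h2, hs0, hs1, hs2, hG, -, rfl⟩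
      refine ⟨m1, m2, s0, s1, s2, G, h1, h12, h2, hs0, hs1, hs2,
        coe_mem_closure_braidPM ?_ hG, by simp⟩
      rintro x ⟨i, ⟨h1, h2⟩, rfl⟩
      exact ⟨i, h1, h2, .inl rfl⟩
    · have key := (loopingSystem n).inv.mul_inv_mul_zpow_mem_span hm hmM hMn (ζ := -ζ)
        (by omega)
      simp only [inv_inv, inv_zpow', neg_neg] at key
      simp only [zpow_neg, zpow_one, inv_inv, ← Units.val_mul]
      refine Submodule.span_mono ?_ key
      rintro x ⟨m1, m2, s0, s1, s2, G, h1, h12, h2, hs0, hs1, hs2, hG, -, rfl⟩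
      rw [loopings_inv_eq_LoopU] at hs0 hs1 hs2
      refine ⟨m1, m2, s0, s1, s2, G, h1, h12, h2, hs0, hs1, hs2,
        coe_mem_closure_braidPM ?_ hG, by simp⟩
      rintro x ⟨i, ⟨h1, h2⟩, rfl⟩
      exact ⟨i, h1, h2, .inr rfl⟩
  · have cX : Commute (tau n m) (tau n M) := commute_looping_looping (commute_g_g_of_lt n)
      (g_braid n) (tau_succ n) (tau_succ n) (commute_g_tau_one n) (commute_g_tau_one n)
      (commute_tau_one_tau_two n) hm hmM hMn
    have cY : Commute (tau n m) (T n M) := commute_looping_looping (commute_g_g_of_lt n)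
      (g_braid n) (tau_succ n) (T_succ n) (commute_g_tau_one n) (commute_g_T_one n)
      (commute_tau_one_T_two n) hm hmM hMn
    have c := ((cX.zpow_zpow ζ ε).mul_right (cY.zpow_zpow ζ (-ε))).eq
    refine Submodule.subset_span ⟨M, M, tau n m ^ ζ, tau n M ^ ε, T n M ^ (-ε), 1, hmM.le, le_rfl,
      le_rfl, ?_, ?_, ?_, one_mem _, ?_⟩
    · rcases hζ with rfl | rfl <;> simp [LoopU]
    · rcases hε with rfl | rfl <;> simp [LoopU]
    · rcases hε with rfl | rfl <;> simp [LoopU]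
    · norm_cast
      rw [mul_one, ← c, mul_assoc]

end MixedHecke
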